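/- Let S₊ be a negative definite even lattice among A₁(2)^k (0 ≤ k ≤ 4), D₄(2), D₄(2)⊕A₁(2), D₆(2), E₇(2), E₈(2), primitively embedded in L₊ ≅ U(2) ⊕ E₈(2). Then the orthogonal complement K₊ = S₊^⊥ in L₊ is isomorphic to U(2) ⊕ S₋, where S₋ is the orthogonal complement of S₊(1/2) in E₈ rescaled by 2. -/

import Mathlib

open Matrix

def E8G : Matrix (Fin 8) (Fin 8) ℤ :=
  !![-2,  1,  0,  0,  0,  0,  0,  0;
      1, -2,  1,  0,  0,  0,  0,  0;
      0,  1, -2,  1,  0,  0,  0,  0;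
      0,  0,  1, -2,  1,  0,  0,  0;
      0,  0,  0,  1, -2,  1,  0,  1;
      0,  0,  0,  0,  1, -2,  1,  0;
      0,  0,  0,  0,  0,  1, -2,  0;
      0,  0,  0,  0,  1,  0,  0, -2]

def E7G : Matrix (Fin 7) (Fin 7) ℤ :=
  !![-2,  1,  0,  0,  0,  0,  0;
      1, -2,  1,  0,  0,  0,  0;
      0,  1, -2,  1,  0,  0,  0;
      0,  0,  1, -2,  1,  0,  1;
      0,  0,  0,  1, -2,  1,  0;
      0,  0,  0,  0,  1, -2,  0;
      0,  0,  0,  1,  0,  0, -2]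

def D6G : Matrix (Fin 6) (Fin 6) ℤ :=
  !![-2,  1,  0,  0,  0,  0;
      1, -2,  1,  0,  0,  0;
      0,  1, -2,  1,  0,  0;
      0,  0,  1, -2,  1,  1;
      0,  0,  0,  1, -2,  0;
      0,  0,  0,  1,  0, -2]

def D4G : Matrix (Fin 4) (Fin 4) ℤ :=
  !![-2,  1,  1,  1;
      1, -2,  0,  0;
      1,  0, -2,  0;
      1,  0,  0, -2]

def D4A1G : Matrix (Fin 5) (Fin 5) ℤ :=
  !![-2,  1,  1,  1,  0;
      1, -2,  0,  0,  0;
      1,  0, -2,  0,  0;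
      1,  0,  0, -2,  0;
      0,  0,  0,  0, -2]

def A1pow (k : ℕ) : Matrix (Fin k) (Fin k) ℤ :=
  Matrix.diagonal fun _ => (-2 : ℤ)

def UG : Matrix (Fin 2) (Fin 2) ℤ := !![0, 1; 1, 0]

/-- Gram matrix of `U ⊕ E₈`. -/
def Gram10 : Matrix (Fin 2 ⊕ Fin 8) (Fin 2 ⊕ Fin 8) ℤ :=
  Matrix.fromBlocks UG 0 0 E8G

/-- The bilinear form of `L₊ ≅ U(2) ⊕ E₈(2) = (U ⊕ E₈)(2)`. -/
def B2 (x y : (Fin 2 ⊕ Fin 8) → ℤ) : ℤ := 2 * (x ⬝ᵥ Gram10.mulVec y)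

/-- The lattices with Gram matrices `G`, `G'` are isometric. -/
def MatIso {m m' : ℕ} (G : Matrix (Fin m) (Fin m) ℤ)
    (G' : Matrix (Fin m') (Fin m') ℤ) : Prop :=
  ∃ e : (Fin m → ℤ) ≃ₗ[ℤ] (Fin m' → ℤ),
    ∀ x y, x ⬝ᵥ G.mulVec y = (e x) ⬝ᵥ G'.mulVec (e y)

section Bilinear

variable {ι κ : Type*}

/-- In a negative definite sublattice with basis `a`, every functional is represented
up to a positive multiple. -/
theorem exists_mem_span_forall_apply_eq [Fintype κ]
    (B : LinearMap.BilinForm ℤ (ι → ℤ)) {a : κ → ι → ℤ}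
    (hli : LinearIndependent ℤ a)
    (hneg : ∀ x ∈ Submodule.span ℤ (Set.range a), x ≠ 0 → B x x < 0) (c : κ → ℤ) :
    ∃ D : ℤ, 0 < D ∧ ∃ s ∈ Submodule.span ℤ (Set.range a), ∀ i, B s (a i) = D * c i := by
  classical
  set M : Matrix κ κ ℤ := Matrix.of fun i j => B (a j) (a i) with hM
  have hMv : ∀ (v : κ → ℤ) i, M.mulVec v i = B (∑ j, v j • a j) (a i) := by
    intro v i
    simp [hM, Matrix.mulVec, dotProduct, map_sum, LinearMap.sum_apply, mul_comm, -zsmul_eq_mul]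
  have hmem : ∀ v : κ → ℤ, ∑ j, v j • a j ∈ Submodule.span ℤ (Set.range a) := fun v =>
    Submodule.sum_mem _ fun j _ =>
      Submodule.smul_mem _ _ (Submodule.subset_span (Set.mem_range_self j))
  have hdet : M.det ≠ 0 := by
    intro h0
    obtain ⟨v, hv, hMv0⟩ := Matrix.exists_mulVec_eq_zero_iff.mpr h0
    have hx : ∑ j, v j • a j ≠ 0 := fun h =>
      hv (funext (Fintype.linearIndependent_iff.mp hli v h))
    have h1 := hneg _ (hmem v) hx
    have h2 : B (∑ j, v j • a j) (∑ j, v j • a j) = 0 := by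
      rw [map_sum (B (∑ j, v j • a j))]
      refine Finset.sum_eq_zero fun i _ => ?_
      rw [map_smul, ← hMv, hMv0]
      simp
    omega
  refine ⟨M.det * M.det, mul_self_pos.mpr hdet, _, hmem (M.det • M.adjugate.mulVec c), ?_⟩
  intro i
  rw [← hMv, Matrix.mulVec_smul, Matrix.mulVec_mulVec, Matrix.mul_adjugate, Matrix.smul_mulVec,
    Matrix.one_mulVec]
  simp [mul_assoc]

/-- A positive multiple of any vector projects orthogonally to a negative definite sublattice. -/
theorem exists_orthogonal_projection [Fintype κ]
    (B : LinearMap.BilinForm ℤ (ι → ℤ)) {a : κ → ι → ℤ}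
    (hli : LinearIndependent ℤ a)
    (hneg : ∀ x ∈ Submodule.span ℤ (Set.range a), x ≠ 0 → B x x < 0) (v : (ι → ℤ)) :
    ∃ D : ℤ, 0 < D ∧ ∃ s ∈ Submodule.span ℤ (Set.range a),
      ∀ t ∈ Submodule.span ℤ (Set.range a), B (D • v - s) t = 0 := by
  obtain ⟨D, hD, s, hs, h⟩ := exists_mem_span_forall_apply_eq B hli hneg fun i => B v (a i)
  refine ⟨D, hD, s, hs, fun t ht => ?_⟩
  induction ht using Submodule.span_induction with
  | mem x hx => obtain ⟨i, rfl⟩ := hx; simp [h, -zsmul_eq_mul]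
  | zero => simp
  | add x y _ _ hx hy => rw [map_add, hx, hy, add_zero]
  | smul r x _ hx => rw [map_smul, hx, smul_zero]

theorem apply_posPart_negPart_nonneg [Fintype κ]
    (B : LinearMap.BilinForm ℤ (ι → ℤ)) {a : κ → ι → ℤ}
    (hoff : ∀ i j, i ≠ j → 0 ≤ B (a i) (a j)) (c : κ → ℤ) :
    0 ≤ B (∑ i, (c i)⁺ • a i) (∑ i, (c i)⁻ • a i) := by
  simp only [map_sum, LinearMap.sum_apply, map_smul, LinearMap.smul_apply, smul_eq_mul]
  refine Finset.sum_nonneg fun i _ => ?_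
  rw [Finset.mul_sum]
  refine Finset.sum_nonneg fun j _ => ?_
  by_cases hij : j = i
  · subst hij
    have : (c j)⁻ * (c j)⁺ = 0 := by
      rcases le_total 0 (c j) with h | h
      · rw [negPart_eq_zero.mpr h, zero_mul]
      · rw [posPart_eq_zero.mpr h, mul_zero]
    rw [← mul_assoc, this, zero_mul]
  · exact mul_nonneg (negPart_nonneg _) (mul_nonneg (posPart_nonneg _) (hoff _ _ hij))

theorem sum_posPart_sub_sum_negPart [Fintype κ] (a : κ → ι → ℤ) (c : κ → ℤ) :
    ∑ i, (c i)⁺ • a i - ∑ i, (c i)⁻ • a i = ∑ i, c i • a i := by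
  rw [← Finset.sum_sub_distrib]
  exact Finset.sum_congr rfl fun i _ => by rw [← sub_smul, posPart_sub_negPart]

/-- Reflections in roots `e j`, `j ∈ J`, move a vector into the chamber cut out by these roots,
as long as the height `B ρ` stays bounded below. -/
theorem exists_isometry_dominant (B : LinearMap.BilinForm ℤ (ι → ℤ)) (hB : ∀ x y, B x y = B y x)
    {τ : Type*} (e : τ → (ι → ℤ)) (J : Set τ) (he : ∀ j, B (e j) (e j) = -2)
    (U : Submodule ℤ (ι → ℤ))
    (hU : ∀ j ∈ J, e j ∈ U) (ρ : ι → ℤ) (hρ : ∀ j ∈ J, 0 < B ρ (e j)) (P : (ι → ℤ) → Prop) (C : ℤ)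
    (hP : ∀ x, P x → ∀ j ∈ J, B x (e j) < 0 → P (x + B x (e j) • e j))
    (hC : ∀ x, P x → C ≤ B ρ x) (h : ι → ℤ) (hh : P h) :
    ∃ g : (ι → ℤ) ≃ₗ[ℤ] (ι → ℤ), (∀ x y, B (g x) (g y) = B x y) ∧ (∀ x, g x - x ∈ U) ∧ P (g h) ∧
      ∀ j ∈ J, 0 ≤ B (g h) (e j) := by
  induction hn : (B ρ h - C).toNat using Nat.strong_induction_on generalizing h with
  | _ n ih =>
    by_cases hdom : ∀ j ∈ J, 0 ≤ B h (e j)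
    · exact ⟨LinearEquiv.refl ℤ (ι → ℤ), fun _ _ => rfl, fun x => by simp, hh, hdom⟩
    push Not at hdom
    obtain ⟨j, hj, hneg⟩ := hdom
    have hf : (-(B (e j))) (e j) = 2 := by simp [he]
    have hr : ∀ x, Module.reflection hf x = x + B x (e j) • e j := by
      intro x
      rw [Module.reflection_apply, LinearMap.neg_apply, hB (e j) x, neg_smul, sub_neg_eq_add]
    have hP' := hP h hh j hj hneg
    have h1 := hC _ hP'
    have h2 : B ρ (h + B h (e j) • e j) = B ρ h + B h (e j) * B ρ (e j) := by
      simp [-zsmul_eq_mul]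
    have h3 : B h (e j) * B ρ (e j) < 0 := mul_neg_of_neg_of_pos hneg (hρ j hj)
    obtain ⟨g, hg, hgU, hgP, hgd⟩ := ih _ (by omega) _ hP' rfl
    refine ⟨(Module.reflection hf).trans g, fun x y => ?_, fun x => ?_, ?_, ?_⟩
    · rw [LinearEquiv.trans_apply, LinearEquiv.trans_apply, hg, hr, hr]
      simp only [map_add, map_smul, LinearMap.add_apply, LinearMap.smul_apply, smul_eq_mul, he,
        hB (e j) y]
      ring
    · rw [LinearEquiv.trans_apply, hr]
      have := U.add_mem (hgU (x + B x (e j) • e j)) (U.smul_mem (B x (e j)) (hU j hj))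
      convert this using 1
      abel
    · rwa [LinearEquiv.trans_apply, hr]
    · intro k hk
      rw [LinearEquiv.trans_apply, hr]
      exact hgd k hk

/-- A basis of simple roots of a primitive negative definite root sublattice. -/
structure IsRootBasis (B : LinearMap.BilinForm ℤ (ι → ℤ)) (a : κ → ι → ℤ) : Prop where
  linearIndependent : LinearIndependent ℤ a
  neg : ∀ x ∈ Submodule.span ℤ (Set.range a), x ≠ 0 → B x x < 0
  primitive : ∀ (n : ℤ) (x : ι → ℤ), n ≠ 0 → n • x ∈ Submodule.span ℤ (Set.range a) →
    x ∈ Submodule.span ℤ (Set.range a)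
  root : ∀ i, B (a i) (a i) = -2
  off : ∀ i j, i ≠ j → 0 ≤ B (a i) (a j)

theorem span_range_comp_linearEquiv (g : (ι → ℤ) ≃ₗ[ℤ] (ι → ℤ)) (a : κ → ι → ℤ) (x : ι → ℤ) :
    g x ∈ Submodule.span ℤ (Set.range (g ∘ a)) ↔ x ∈ Submodule.span ℤ (Set.range a) := by
  rw [Set.range_comp, ← LinearEquiv.coe_coe, ← Submodule.map_span]
  exact ⟨fun ⟨y, hy, hyx⟩ => g.injective hyx ▸ hy, fun h => ⟨x, h, rfl⟩⟩

theorem IsRootBasis.comp {B : LinearMap.BilinForm ℤ (ι → ℤ)} {a : κ → ι → ℤ}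
    (ha : IsRootBasis B a)
    (g : (ι → ℤ) ≃ₗ[ℤ] (ι → ℤ)) (hg : ∀ x y, B (g x) (g y) = B x y) : IsRootBasis B (g ∘ a) where
  linearIndependent := ha.linearIndependent.map' (g : (ι → ℤ) →ₗ[ℤ] (ι → ℤ)) g.ker
  neg := by
    intro x hx hx0
    obtain ⟨y, rfl⟩ := g.surjective x
    rw [span_range_comp_linearEquiv] at hx
    rw [hg]
    exact ha.neg y hx fun h => hx0 (by simp [h])
  primitive := by
    intro n x hn hx
    obtain ⟨y, rfl⟩ := g.surjective x
    rw [← map_smul, span_range_comp_linearEquiv] at hx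
    rw [span_range_comp_linearEquiv]
    exact ha.primitive n y hn hx
  root := fun i => by simp [hg, ha.root]
  off := fun i j hij => by simpa [hg] using ha.off i j hij

/-- Roots have coordinates of constant sign in a basis of simple roots. -/
theorem IsRootBasis.nonneg_or_nonpos [Fintype κ] {B : LinearMap.BilinForm ℤ (ι → ℤ)}
    (hB : ∀ x y, B x y = B y x)
    (heven : ∀ x, Even (B x x)) {a : κ → ι → ℤ} (ha : IsRootBasis B a) (c : κ → ℤ)
    (hc : B (∑ i, c i • a i) (∑ i, c i • a i) = -2) : (∀ i, 0 ≤ c i) ∨ ∀ i, c i ≤ 0 := by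
  by_contra! hcon
  obtain ⟨⟨k, hk⟩, l, hl⟩ := hcon
  have hmem : ∀ v : κ → ℤ, ∑ j, v j • a j ∈ Submodule.span ℤ (Set.range a) := fun v =>
    Submodule.sum_mem _ fun j _ =>
      Submodule.smul_mem _ _ (Submodule.subset_span (Set.mem_range_self j))
  have hne : ∀ (v : κ → ℤ) (i : κ), v i ≠ 0 → ∑ j, v j • a j ≠ 0 := fun v i hv h =>
    hv (Fintype.linearIndependent_iff.mp ha.linearIndependent v h i)
  have hp := ha.neg _ (hmem fun i => (c i)⁺) (hne _ l (posPart_pos hl).ne')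
  have hn := ha.neg _ (hmem fun i => (c i)⁻) (hne _ k (negPart_pos hk).ne')
  have hpn := apply_posPart_negPart_nonneg B ha.off c
  rw [← sum_posPart_sub_sum_negPart] at hc
  set p := ∑ i, (c i)⁺ • a i
  set n := ∑ i, (c i)⁻ • a i
  have hpe := heven p
  have hne := heven n
  simp only [map_sub, LinearMap.sub_apply, hB n p] at hc
  rw [Int.even_iff] at hpe hne
  omega

end Bilinear

/-- The Gram matrix of the `E₁₀` diagram: the chain `9 - 8 - 0 - 1 - 2 - 3 - 4 - 5 - 6`
with the node `7` attached to `4`. -/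
def E10G : Matrix (Fin 10) (Fin 10) ℤ :=
  !![-2,  1,  0,  0,  0,  0,  0,  0,  1,  0;
      1, -2,  1,  0,  0,  0,  0,  0,  0,  0;
      0,  1, -2,  1,  0,  0,  0,  0,  0,  0;
      0,  0,  1, -2,  1,  0,  0,  0,  0,  0;
      0,  0,  0,  1, -2,  1,  0,  1,  0,  0;
      0,  0,  0,  0,  1, -2,  1,  0,  0,  0;
      0,  0,  0,  0,  0,  1, -2,  0,  0,  0;
      0,  0,  0,  0,  1,  0,  0, -2,  0,  0;
      1,  0,  0,  0,  0,  0,  0,  0, -2,  1;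
      0,  0,  0,  0,  0,  0,  0,  0,  1, -2]

section E10

/-- The bilinear form of the `E₁₀` lattice in the basis of simple roots. -/
def formE10 : LinearMap.BilinForm ℤ (Fin 10 → ℤ) := Matrix.toBilin' E10G

/-- The simple roots of `E₁₀`. -/
abbrev simpleRoot (i : Fin 10) : Fin 10 → ℤ := Pi.single i 1

/-- The inverse of `E10G`; its rows are the fundamental weights. -/
def E10Inv : Matrix (Fin 10) (Fin 10) ℤ :=
  !![ 6,  9, 12, 15, 18, 12,  6,  9,  4,  2;
      9, 12, 16, 20, 24, 16,  8, 12,  6,  3;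
     12, 16, 20, 25, 30, 20, 10, 15,  8,  4;
     15, 20, 25, 30, 36, 24, 12, 18, 10,  5;
     18, 24, 30, 36, 42, 28, 14, 21, 12,  6;
     12, 16, 20, 24, 28, 18,  9, 14,  8,  4;
      6,  8, 10, 12, 14,  9,  4,  7,  4,  2;
      9, 12, 15, 18, 21, 14,  7, 10,  6,  3;
      4,  6,  8, 10, 12,  8,  4,  6,  2,  1;
      2,  3,  4,  5,  6,  4,  2,  3,  1,  0]

theorem E10Inv_mul_E10G : E10Inv * E10G = 1 := by decide +kernel

theorem formE10_apply (x y : Fin 10 → ℤ) : formE10 x y = x ⬝ᵥ E10G *ᵥ y :=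
  Matrix.toBilin'_apply' _ _ _

theorem formE10_simpleRoot (i j : Fin 10) :
    formE10 (simpleRoot i) (simpleRoot j) = E10G i j :=
  Matrix.toBilin'_single _ _ _

theorem E10G_diag (i : Fin 10) : E10G i i = -2 := by fin_cases i <;> rfl

theorem E10G_off : ∀ i j : Fin 10, i ≠ j → 0 ≤ E10G i j := by
  intro i j hij
  fin_cases i <;> fin_cases j <;> first | decide | exact absurd rfl hij

theorem formE10_comm (x y : Fin 10 → ℤ) : formE10 x y = formE10 y x := by
  have hT : E10Gᵀ = E10G := by decide +kernel
  rw [formE10_apply, formE10_apply, Matrix.dotProduct_mulVec, ← Matrix.mulVec_transpose, hT,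
    dotProduct_comm]

/-- The row `k` of the inverse Gram matrix pairs to the coordinate `k`. -/
theorem formE10_E10Inv (k : Fin 10) (x : Fin 10 → ℤ) : formE10 (E10Inv k) x = x k := by
  rw [formE10_apply, Matrix.dotProduct_mulVec]
  have h : E10Inv k ᵥ* E10G = Pi.single k 1 := by
    have : E10Inv k ᵥ* E10G = (E10Inv * E10G) k := rfl
    rw [this, E10Inv_mul_E10G]
    exact funext fun _ => Matrix.one_eq_pi_single
  rw [h, single_dotProduct, one_mul]

theorem E8_neg {y : Fin 8 → ℤ} (hy : 0 ≤ y ⬝ᵥ E8G *ᵥ y) : y = 0 := by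
  have key : -60 * (y ⬝ᵥ E8G *ᵥ y) = 30 * (2 * y 0 - y 1) ^ 2 + 10 * (3 * y 1 - 2 * y 2) ^ 2 +
      5 * (4 * y 2 - 3 * y 3) ^ 2 + 3 * (5 * y 3 - 4 * y 4) ^ 2 + 30 * (2 * y 6 - y 5) ^ 2 +
      10 * (3 * y 5 - 2 * y 4) ^ 2 + 30 * (2 * y 7 - y 4) ^ 2 + 2 * y 4 ^ 2 := by
    simp [E8G, dotProduct, Matrix.mulVec, Fin.sum_univ_succ]
    ring
  have h0 := sq_nonneg (2 * y 0 - y 1)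
  have h1 := sq_nonneg (3 * y 1 - 2 * y 2)
  have h2 := sq_nonneg (4 * y 2 - 3 * y 3)
  have h3 := sq_nonneg (5 * y 3 - 4 * y 4)
  have h4 := sq_nonneg (2 * y 6 - y 5)
  have h5 := sq_nonneg (3 * y 5 - 2 * y 4)
  have h6 := sq_nonneg (2 * y 7 - y 4)
  have h7 := sq_nonneg (y 4)
  have e0 := pow_eq_zero_iff (two_ne_zero) |>.mp (le_antisymm (by linarith) h0)
  have e1 := pow_eq_zero_iff (two_ne_zero) |>.mp (le_antisymm (by linarith) h1)
  have e2 := pow_eq_zero_iff (two_ne_zero) |>.mp (le_antisymm (by linarith) h2)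
  have e3 := pow_eq_zero_iff (two_ne_zero) |>.mp (le_antisymm (by linarith) h3)
  have e4 := pow_eq_zero_iff (two_ne_zero) |>.mp (le_antisymm (by linarith) h4)
  have e5 := pow_eq_zero_iff (two_ne_zero) |>.mp (le_antisymm (by linarith) h5)
  have e6 := pow_eq_zero_iff (two_ne_zero) |>.mp (le_antisymm (by linarith) h6)
  have e7 := pow_eq_zero_iff (two_ne_zero) |>.mp (le_antisymm (by linarith) h7)
  funext i
  fin_cases i <;> simp <;> omega

/-- The coefficients of the highest root of `E₈`. -/
def marksE8 : Fin 8 → ℤ := ![2, 3, 4, 5, 6, 4, 2, 3]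

/-- The isometry from `E₁₀` to `U ⊕ E₈`. -/
def toHyperbolic : (Fin 10 → ℤ) ≃ₗ[ℤ] (Fin 2 ⊕ Fin 8 → ℤ) where
  toFun x := Sum.elim ![x 8 - x 9, x 9] fun i => x (Fin.castLE (by norm_num) i) - marksE8 i * x 8
  map_add' x y := by
    ext (i | i)
    · fin_cases i
      · simp; ring
      · simp
    · simp; ring
  map_smul' c x := by
    ext (i | i)
    · fin_cases i
      · simp; ring
      · simp
    · simp; ring
  invFun z := fun j => if h : (j : ℕ) < 8 then
      z (Sum.inr ⟨j, h⟩) + marksE8 ⟨j, h⟩ * (z (Sum.inl 0) + z (Sum.inl 1))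
    else if j = 8 then z (Sum.inl 0) + z (Sum.inl 1) else z (Sum.inl 1)
  left_inv x := by
    ext j
    fin_cases j <;> simp
  right_inv z := by
    ext (i | i)
    · fin_cases i <;> simp
    · fin_cases i <;> simp

theorem toHyperbolic_isometry (x y : Fin 10 → ℤ) :
    toHyperbolic x ⬝ᵥ Gram10 *ᵥ toHyperbolic y = formE10 x y := by
  have h : (Matrix.toBilin' Gram10).compl₁₂ (toHyperbolic : (Fin 10 → ℤ) →ₗ[ℤ] _)
      (toHyperbolic : (Fin 10 → ℤ) →ₗ[ℤ] _) = formE10 := by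
    refine LinearMap.BilinForm.ext_basis (Pi.basisFun ℤ (Fin 10)) fun i j => ?_
    simp only [Pi.basisFun_apply, formE10_simpleRoot, LinearMap.compl₁₂_apply,
      Matrix.toBilin'_apply', LinearEquiv.coe_coe]
    fin_cases i <;> fin_cases j <;> decide +kernel
  rw [← h, LinearMap.compl₁₂_apply, Matrix.toBilin'_apply']
  rfl

theorem formE10_self (x : Fin 10 → ℤ) : formE10 x x = 2 * ((x 8 - x 9) * x 9) +
    (fun i : Fin 8 => x (Fin.castLE (by norm_num) i) - marksE8 i * x 8) ⬝ᵥ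
      E8G *ᵥ (fun i : Fin 8 => x (Fin.castLE (by norm_num) i) - marksE8 i * x 8) := by
  rw [← toHyperbolic_isometry]
  simp [dotProduct, Matrix.mulVec, Gram10, UG, toHyperbolic]
  ring

theorem formE10_even (x : Fin 10 → ℤ) : Even (formE10 x x) := by
  rw [formE10_apply]
  refine ⟨-(x 0 ^ 2 + x 1 ^ 2 + x 2 ^ 2 + x 3 ^ 2 + x 4 ^ 2 + x 5 ^ 2 + x 6 ^ 2 + x 7 ^ 2 +
    x 8 ^ 2 + x 9 ^ 2) + (x 9 * x 8 + x 8 * x 0 + x 0 * x 1 + x 1 * x 2 + x 2 * x 3 + x 3 * x 4 +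
    x 4 * x 5 + x 5 * x 6 + x 4 * x 7), ?_⟩
  simp [E10G, dotProduct, Matrix.mulVec, Fin.sum_univ_succ]
  ring

/-- The coefficients of the isotropic root of the affine subdiagram obtained by removing
the node `9`. -/
def affineRoot : Fin 10 → ℤ := ![2, 3, 4, 5, 6, 4, 2, 3, 1, 0]

theorem eq_smul_affineRoot {x : Fin 10 → ℤ} (h9 : x 9 = 0) (hx : 0 ≤ formE10 x x) :
    x = x 8 • affineRoot := by
  rw [formE10_self, h9, mul_zero, mul_zero, zero_add] at hx
  have h := E8_neg hx
  funext i
  by_cases hi : (i : ℕ) < 8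
  · have := congrFun h ⟨i, hi⟩
    have hm : marksE8 ⟨i, hi⟩ = affineRoot i := by
      fin_cases i <;> first | rfl | exact absurd hi (by decide)
    simp only [Pi.zero_apply, hm] at this
    simp only [Pi.smul_apply, smul_eq_mul]
    have e : Fin.castLE (by norm_num) (⟨i, hi⟩ : Fin 8) = i := rfl
    rw [e] at this
    linarith
  · have : i = 8 ∨ i = 9 := by omega
    rcases this with rfl | rfl
    · simp [affineRoot]
    · simp [affineRoot, h9]

/-- The orthogonal complement of a certain vector of positive norm is negative definite. -/
theorem formE10_neg_of_orthogonal {x : Fin 10 → ℤ} (h : x 8 = 0) (hx : 0 ≤ formE10 x x) :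
    x = 0 := by
  rw [formE10_self, h] at hx
  have h9 : x 9 = 0 := by
    by_contra h9
    have : 0 < x 9 * x 9 := mul_self_pos.mpr h9
    have h8 := E8_neg (y := fun i : Fin 8 => x (Fin.castLE (by norm_num) i) - marksE8 i * 0)
      (by linarith)
    rw [h8] at hx
    simp at hx
    linarith
  rw [eq_smul_affineRoot h9 (by rw [formE10_self, h]; exact hx), h, zero_smul]

/-- The lattice `E₁₀` is hyperbolic. -/
theorem formE10_hyperbolic {x y : Fin 10 → ℤ} (hx : 0 < formE10 x x) (hxy : formE10 x y = 0)
    (hy : y ≠ 0) : formE10 y y < 0 := by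
  by_contra! hyy
  have hz : y 8 • x - x 8 • y = 0 := by
    refine formE10_neg_of_orthogonal (by simp; ring) ?_
    simp only [map_sub, map_smul, LinearMap.sub_apply, LinearMap.smul_apply, smul_eq_mul, hxy,
      formE10_comm y x]
    nlinarith [mul_nonneg (mul_self_nonneg (y 8)) hx.le, mul_nonneg (mul_self_nonneg (x 8)) hyy]
  have h := congrArg (formE10 x) hz
  simp only [map_sub, map_smul, smul_eq_mul, hxy, map_zero, mul_zero, sub_zero,
    mul_eq_zero] at h
  exact hy (formE10_neg_of_orthogonal (h.resolve_right hx.ne') hyy)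

theorem sum_smul_simpleRoot (x : Fin 10 → ℤ) : ∑ i, x i • simpleRoot i = x :=
  (pi_eq_sum_univ' x).symm

/-- Vectors with a vanishing coordinate have negative norm or are proportional to the
isotropic affine root. -/
theorem formE10_neg_of_apply_eq_zero {x : Fin 10 → ℤ} {k : Fin 10} (hk : x k = 0) (hx : x ≠ 0) :
    formE10 x x < 0 ∨ k = 9 ∧ x = x 8 • affineRoot := by
  by_cases h9 : k = 9
  · subst h9
    rcases lt_or_ge (formE10 x x) 0 with h | h
    · exact Or.inl h
    · exact Or.inr ⟨rfl, eq_smul_affineRoot hk h⟩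
  · refine Or.inl (formE10_hyperbolic (x := E10Inv k) ?_ (by rw [formE10_E10Inv, hk]) hx)
    rw [formE10_E10Inv]
    fin_cases k <;> first | decide | exact absurd rfl h9

theorem formE10_affineRoot_nine (x : Fin 10 → ℤ) : formE10 affineRoot x = x 9 := by
  have : affineRoot = E10Inv 9 := by decide +kernel
  rw [this, formE10_E10Inv]

/-- The roots of `E₁₀` are nonnegative or nonpositive combinations of simple roots. -/
theorem formE10_nonneg_or_nonpos {x : Fin 10 → ℤ} (hx : formE10 x x = -2) :
    (∀ i, 0 ≤ x i) ∨ ∀ i, x i ≤ 0 := by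
  by_contra! hcon
  obtain ⟨⟨k, hk⟩, l, hl⟩ := hcon
  have hpn := apply_posPart_negPart_nonneg formE10 (a := simpleRoot)
    (fun i j hij => by rw [formE10_simpleRoot]; exact E10G_off i j hij) x
  have hd := sum_posPart_sub_sum_negPart simpleRoot x
  rw [sum_smul_simpleRoot x] at hd
  rw [sum_smul_simpleRoot fun i => (x i)⁺, sum_smul_simpleRoot fun i => (x i)⁻] at hpn hd
  obtain ⟨p, hp⟩ : ∃ p : Fin 10 → ℤ, p = fun i => (x i)⁺ := ⟨_, rfl⟩
  obtain ⟨n, hn⟩ : ∃ n : Fin 10 → ℤ, n = fun i => (x i)⁻ := ⟨_, rfl⟩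
  rw [← hp, ← hn] at hpn hd
  have hpk : p k = 0 := by rw [hp]; exact posPart_eq_zero.mpr hk.le
  have hnk : 0 < n k := by rw [hn]; exact negPart_pos hk
  have hnl : n l = 0 := by rw [hn]; exact negPart_eq_zero.mpr hl.le
  have hpl : 0 < p l := by rw [hp]; exact posPart_pos hl
  have hp0 : ∀ i, 0 ≤ p i := fun i => by rw [hp]; exact posPart_nonneg _
  have hn0 : ∀ i, 0 ≤ n i := fun i => by rw [hn]; exact negPart_nonneg _
  have hx2 : formE10 p p + formE10 n n - 2 * formE10 p n = -2 := by
    rw [← hx, ← hd]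
    simp only [map_sub, LinearMap.sub_apply, formE10_comm n p]
    ring
  have hpe := formE10_even p
  have hne := formE10_even n
  rw [Int.even_iff] at hpe hne
  have hp0' : p ≠ 0 := fun h => by simp [h] at hpl
  have hn0' : n ≠ 0 := fun h => by simp [h] at hnk
  rcases formE10_neg_of_apply_eq_zero hpk hp0' with hpp | ⟨rfl, hpa⟩
  · rcases formE10_neg_of_apply_eq_zero hnl hn0' with hnn | ⟨rfl, hna⟩
    · omega
    · have h1 : ∀ y, formE10 n y = n 8 * y 9 := fun y => by
        rw [hna, map_smul, LinearMap.smul_apply, formE10_affineRoot_nine]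
        simp [affineRoot]
      have h8 : 0 < n 8 := (hn0 8).lt_of_ne fun h => hn0' (by rw [hna, ← h, zero_smul])
      have h2 := h1 n
      have h3 := mul_pos h8 hpl
      rw [← h1, formE10_comm] at h3
      rw [hnl, mul_zero] at h2
      omega
  · rcases formE10_neg_of_apply_eq_zero hnl hn0' with hnn | ⟨rfl, hna⟩
    · have h1 : ∀ y, formE10 p y = p 8 * y 9 := fun y => by
        rw [hpa, map_smul, LinearMap.smul_apply, formE10_affineRoot_nine]
        simp [affineRoot]
      have h8 : 0 < p 8 := (hp0 8).lt_of_ne fun h => hp0' (by rw [hpa, ← h, zero_smul])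
      have h2 := h1 p
      have h3 := mul_pos h8 hnk
      rw [← h1] at h3
      rw [hpk, mul_zero] at h2
      omega
    · omega

end E10

instance (a b : Fin 10) (n : ℤ) : Decidable (E10G a b = n) := Int.instDecidableEq _ _

/-- Replace the node `p.1` of `l` by `p.2` if all other nodes of `l` are orthogonal to both. -/
def slide (l : List (Fin 10)) (p : Fin 10 × Fin 10) : List (Fin 10) :=
  if ∀ c ∈ l, c ≠ p.1 → E10G c p.1 = 0 ∧ E10G c p.2 = 0 then
    l.map fun c => if c = p.1 then p.2 else c
  else l

/-- A sequence of slides that brings all independent sets of at most four nodes of the same size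
to the same position. -/
def slidesA1 : List (Fin 10 × Fin 10) :=
  [(5, 6), (8, 9), (1, 0), (3, 2), (7, 4), (9, 8), (8, 0), (2, 3), (3, 4), (4, 5), (5, 6), (2, 3),
    (3, 4), (0, 1), (1, 2), (9, 8), (8, 0), (2, 3), (3, 4), (0, 1), (1, 2), (4, 5), (4, 3), (6, 5),
    (2, 3)]

def slidesD4A1 : List (Fin 10 × Fin 10) := [(1, 0), (0, 8), (8, 9)]

theorem slides_A1_one (a : Fin 10) : ∀ c, c ∈ slidesA1.foldl slide [a] ↔ c ∈ [5] := by
  revert a; decide +kernel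

theorem slides_A1_two : ∀ a b : Fin 10, a < b → E10G a b = 0 →
    ∀ x, x ∈ slidesA1.foldl slide [a, b] ↔ x ∈ [3, 5] := by
  decide +kernel

theorem slides_A1_three : ∀ a b : Fin 10, a < b → E10G a b = 0 →
    ∀ c, b < c → E10G a c = 0 → E10G b c = 0 →
    ∀ x, x ∈ slidesA1.foldl slide [a, b, c] ↔ x ∈ [2, 4, 6] := by
  decide +kernel

theorem slides_A1_four : ∀ a b : Fin 10, a < b → E10G a b = 0 →
    ∀ c, b < c → E10G a c = 0 → E10G b c = 0 →
    ∀ d, c < d → E10G a d = 0 → E10G b d = 0 → E10G c d = 0 →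
    ∀ x, x ∈ slidesA1.foldl slide [a, b, c, d] ↔ x ∈ [0, 2, 4, 6] := by
  decide +kernel

theorem nodes_D4 : ∀ a b : Fin 10, E10G a b = 1 → ∀ c, E10G a c = 1 → E10G b c = 0 →
    ∀ d, E10G a d = 1 → E10G b d = 0 → E10G c d = 0 →
    ∀ x, x ∈ [a, b, c, d] ↔ x ∈ [3, 4, 5, 7] := by
  decide +kernel

theorem slides_D4A1 : ∀ a b : Fin 10, E10G a b = 1 → ∀ c, E10G a c = 1 → E10G b c = 0 →
    ∀ d, E10G a d = 1 → E10G b d = 0 → E10G c d = 0 →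
    ∀ e, E10G a e = 0 → E10G b e = 0 → E10G c e = 0 → E10G d e = 0 →
    ∀ x, x ∈ slidesD4A1.foldl slide [a, b, c, d, e] ↔ x ∈ [3, 4, 5, 7, 9] := by
  decide +kernel

section RootSublattices

/-- The sublattice spanned by the simple roots in `J`. -/
def coordSub (J : Finset (Fin 10)) : Submodule ℤ (Fin 10 → ℤ) where
  carrier := {x | ∀ i, i ∉ J → x i = 0}
  add_mem' hx hy i hi := by rw [Pi.add_apply, hx i hi, hy i hi, add_zero]
  zero_mem' _ _ := rfl
  smul_mem' c x hx i hi := by rw [Pi.smul_apply, hx i hi, smul_zero]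

theorem simpleRoot_mem_coordSub {J : Finset (Fin 10)} {j : Fin 10} (hj : j ∈ J) :
    simpleRoot j ∈ coordSub J := by
  intro i hi
  rw [simpleRoot, Pi.single_eq_of_ne]
  rintro rfl
  exact hi hj

theorem coordSub_le {J : Finset (Fin 10)} {N : Submodule ℤ (Fin 10 → ℤ)}
    (h : ∀ j ∈ J, simpleRoot j ∈ N) : coordSub J ≤ N := by
  intro x hx
  rw [← sum_smul_simpleRoot x]
  refine N.sum_mem fun i _ => ?_
  by_cases hi : i ∈ J
  · exact N.smul_mem _ (h i hi)
  · rw [hx i hi, zero_smul]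
    exact N.zero_mem

theorem span_simpleRoot_le (J : Finset (Fin 10)) :
    Submodule.span ℤ (Set.range fun j : J => simpleRoot j) ≤ coordSub J := by
  rw [Submodule.span_le]
  rintro _ ⟨j, rfl⟩
  exact simpleRoot_mem_coordSub j.2

/-- The Gram form is negative definite on the sublattice spanned by the simple roots in `J`. -/
def NegDefOn (J : Finset (Fin 10)) : Prop := ∀ x ∈ coordSub J, x ≠ 0 → formE10 x x < 0

theorem NegDefOn.nonpos {J : Finset (Fin 10)} (hJ : NegDefOn J) {x : Fin 10 → ℤ}
    (hx : x ∈ coordSub J) : formE10 x x ≤ 0 := by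
  by_cases h : x = 0
  · simp [h]
  · exact (hJ x hx h).le

theorem formE10_eq_sum (h x : Fin 10 → ℤ) :
    formE10 h x = ∑ i, x i * formE10 h (simpleRoot i) := by
  conv_lhs => rw [← sum_smul_simpleRoot x]
  simp only [map_sum, map_smul, smul_eq_mul]

theorem formE10_simpleRoot_self (j : Fin 10) : formE10 (simpleRoot j) (simpleRoot j) = -2 := by
  rw [formE10_simpleRoot, E10G_diag]

theorem formE10_reflection (x : Fin 10 → ℤ) (j : Fin 10) :
    formE10 (x + formE10 x (simpleRoot j) • simpleRoot j)
      (x + formE10 x (simpleRoot j) • simpleRoot j) = formE10 x x := by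
  simp only [map_add, map_smul, LinearMap.add_apply, LinearMap.smul_apply, smul_eq_mul,
    formE10_simpleRoot_self, formE10_comm (simpleRoot j) x]
  ring

/-- The Weyl vector of `E₁₀`. -/
def weylVector : Fin 10 → ℤ := ![93, 126, 160, 195, 231, 153, 76, 115, 61, 30]

theorem formE10_weylVector (x : Fin 10 → ℤ) : formE10 weylVector x = ∑ i, x i := by
  have h : weylVector ᵥ* E10G = 1 := by decide +kernel
  rw [formE10_apply, Matrix.dotProduct_mulVec, h, one_dotProduct]

theorem formE10_weylVector_self : formE10 weylVector weylVector = 1240 := by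
  rw [formE10_weylVector]
  decide +kernel

/-- Vectors of a finite root sublattice can be moved into the closed chamber. -/
theorem NegDefOn.exists_isometry_dominant {J : Finset (Fin 10)} (hJ : NegDefOn J)
    {h : Fin 10 → ℤ} (hh : h ∈ coordSub J) :
    ∃ g : (Fin 10 → ℤ) ≃ₗ[ℤ] (Fin 10 → ℤ), (∀ x y, formE10 (g x) (g y) = formE10 x y) ∧
      (∀ x, g x - x ∈ coordSub J) ∧ ∀ j ∈ J, 0 ≤ formE10 (g h) (simpleRoot j) := by
  have hli : LinearIndependent ℤ fun j : J => simpleRoot j := by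
    have h := (Pi.basisFun ℤ (Fin 10)).linearIndependent.comp (Subtype.val : J → Fin 10)
      Subtype.val_injective
    have e : (Pi.basisFun ℤ (Fin 10) : Fin 10 → Fin 10 → ℤ) ∘ Subtype.val =
        fun j : J => simpleRoot j := by
      funext j
      simp
    rwa [e] at h
  obtain ⟨D, hD, ρ, hρ, hρe⟩ := exists_mem_span_forall_apply_eq formE10 hli
    (fun x hx => hJ x (span_simpleRoot_le J hx)) fun _ => 1
  have hρJ := span_simpleRoot_le J hρ
  obtain ⟨g, hg, hgU, -, hd⟩ := _root_.exists_isometry_dominant formE10 formE10_comm simpleRoot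
    (J : Set (Fin 10)) formE10_simpleRoot_self (coordSub J) (fun j hj => simpleRoot_mem_coordSub hj)
    ρ (fun j hj => by rw [hρe ⟨j, hj⟩, mul_one]; exact hD)
    (fun x => x ∈ coordSub J ∧ formE10 x x = formE10 h h) (formE10 ρ ρ + formE10 h h)
    (fun x hx j hj _ => ⟨(coordSub J).add_mem hx.1
      ((coordSub J).smul_mem _ (simpleRoot_mem_coordSub hj)), by rw [formE10_reflection, hx.2]⟩)
    (fun x hx => by
      have h1 := hJ.nonpos ((coordSub J).sub_mem hρJ hx.1)
      simp only [map_sub, LinearMap.sub_apply, formE10_comm x ρ] at h1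
      have h2 := hJ.nonpos hρJ
      have h3 := hJ.nonpos hh
      have h4 := hx.2
      omega) h ⟨hh, rfl⟩
  exact ⟨g, hg, hgU, hd⟩

/-- Vectors of the positive cone can be moved into the closed chamber. -/
theorem exists_isometry_dominant_of_pos {h : Fin 10 → ℤ} (hh : 0 < formE10 h h)
    (hρ : 0 < formE10 weylVector h) :
    ∃ g : (Fin 10 → ℤ) ≃ₗ[ℤ] (Fin 10 → ℤ), (∀ x y, formE10 (g x) (g y) = formE10 x y) ∧
      ∀ j, 0 ≤ formE10 (g h) (simpleRoot j) := by
  have hP : ∀ x, formE10 x x = formE10 h h ∧ 0 < formE10 weylVector x → ∀ j ∈ Set.univ,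
      formE10 x (simpleRoot j) < 0 →
      formE10 (x + formE10 x (simpleRoot j) • simpleRoot j)
        (x + formE10 x (simpleRoot j) • simpleRoot j) = formE10 h h ∧
      0 < formE10 weylVector (x + formE10 x (simpleRoot j) • simpleRoot j) := by
    rintro x ⟨hxx, hx⟩ j - -
    have hx' := formE10_reflection x j
    have hm : formE10 x (x + formE10 x (simpleRoot j) • simpleRoot j) =
        formE10 x x + formE10 x (simpleRoot j) * formE10 x (simpleRoot j) := by
      simp only [map_add, map_smul, smul_eq_mul]
    have hc := mul_self_nonneg (formE10 x (simpleRoot j))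
    set y := x + formE10 x (simpleRoot j) • simpleRoot j
    refine ⟨hx'.trans hxx, ?_⟩
    by_contra! hy
    have hxy : 0 < formE10 x y := by omega
    set a := formE10 weylVector x
    set b := formE10 weylVector y with hb
    have hz0 : formE10 weylVector (a • y - b • x) = 0 := by
      simp only [map_sub, map_smul, smul_eq_mul]
      exact sub_eq_zero.mpr (mul_comm _ _)
    have hzz : 0 < formE10 (a • y - b • x) (a • y - b • x) := by
      simp only [map_sub, map_smul, smul_eq_mul, LinearMap.sub_apply, LinearMap.smul_apply, hx',
        formE10_comm y x, hxx]
      have h1 := mul_pos (mul_pos hx hx) hh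
      have h2 := mul_nonneg (mul_nonneg hx.le (neg_nonneg.mpr hy)) hxy.le
      have h3 := mul_nonneg (mul_self_nonneg b) hh.le
      nlinarith
    refine absurd (formE10_hyperbolic (by rw [formE10_weylVector_self]; norm_num) hz0 ?_) hzz.not_gt
    intro h0
    rw [h0, map_zero] at hzz
    exact lt_irrefl _ hzz
  obtain ⟨g, hg, -, -, hd⟩ := exists_isometry_dominant formE10 formE10_comm simpleRoot Set.univ
    formE10_simpleRoot_self ⊤ (fun _ _ => Submodule.mem_top) weylVector
    (fun j _ => by rw [formE10_weylVector]; simp) _ 0 hP (fun x hx => hx.2.le) h ⟨rfl, hρ⟩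
  exact ⟨g, hg, fun j => hd j trivial⟩

/-- Roots orthogonal to a dominant vector are combinations of simple roots orthogonal to it. -/
theorem mem_coordSub_filter {J : Finset (Fin 10)} {h x : Fin 10 → ℤ}
    (hd : ∀ j ∈ J, 0 ≤ formE10 h (simpleRoot j)) (hx : x ∈ coordSub J) (hxx : formE10 x x = -2)
    (hhx : formE10 h x = 0) : x ∈ coordSub (J.filter fun j => formE10 h (simpleRoot j) = 0) := by
  have hterm : ∀ i, x i * formE10 h (simpleRoot i) = 0 := by
    rw [formE10_eq_sum] at hhx
    rcases formE10_nonneg_or_nonpos hxx with hs | hs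
    · have := (Finset.sum_eq_zero_iff_of_nonneg fun i _ => ?_).mp hhx
      · exact fun i => this i (Finset.mem_univ i)
      · by_cases hi : i ∈ J
        · exact mul_nonneg (hs i) (hd i hi)
        · rw [hx i hi, zero_mul]
    · have := (Finset.sum_eq_zero_iff_of_nonpos fun i _ => ?_).mp hhx
      · exact fun i => this i (Finset.mem_univ i)
      · by_cases hi : i ∈ J
        · exact mul_nonpos_of_nonpos_of_nonneg (hs i) (hd i hi)
        · rw [hx i hi, zero_mul]
  intro i hi
  by_cases hiJ : i ∈ J
  · refine (mul_eq_zero.mp (hterm i)).resolve_right fun h0 => hi ?_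
    exact Finset.mem_filter.mpr ⟨hiJ, h0⟩
  · exact hx i hiJ

variable {κ : Type*}

theorem IsRootBasis.exists_isometry_mem_coordSub [Fintype κ] {a : κ → Fin 10 → ℤ}
    (ha : IsRootBasis formE10 a) :
    ∃ g : (Fin 10 → ℤ) ≃ₗ[ℤ] (Fin 10 → ℤ), (∀ x y, formE10 (g x) (g y) = formE10 x y) ∧
      ∃ J, NegDefOn J ∧ ∀ i, g (a i) ∈ coordSub J := by
  obtain ⟨D, hD, s, hs, hort⟩ :=
    exists_orthogonal_projection formE10 ha.linearIndependent ha.neg weylVector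
  have hss : formE10 s s ≤ 0 := by
    by_cases h : s = 0
    · simp [h]
    · exact (ha.neg s hs h).le
  obtain ⟨h, hh⟩ : ∃ h, h = D • weylVector - s := ⟨_, rfl⟩
  rw [← hh] at hort
  have hDh : D * formE10 weylVector h = formE10 h h := by
    have : D • weylVector = h + s := by rw [hh, sub_add_cancel]
    rw [formE10_comm, ← smul_eq_mul, ← map_smul, this, map_add, hort s hs, add_zero]
  have hpos : 0 < formE10 h h := by
    have : formE10 (D • weylVector) (D • weylVector) = formE10 h h + formE10 s s := by
      have : D • weylVector = h + s := by rw [hh, sub_add_cancel]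
      rw [this]
      simp only [map_add, LinearMap.add_apply, formE10_comm s h, hort s hs]
      ring
    simp only [map_smul, LinearMap.smul_apply, smul_eq_mul, formE10_weylVector_self] at this
    nlinarith [mul_pos hD hD]
  obtain ⟨g, hg, hd⟩ := exists_isometry_dominant_of_pos hpos
    (pos_of_mul_pos_right (hDh ▸ hpos) hD.le)
  refine ⟨g, hg, Finset.univ.filter fun j => formE10 (g h) (simpleRoot j) = 0, ?_, fun i => ?_⟩
  · intro x hx hx0
    refine formE10_hyperbolic (x := g h) (by rwa [hg]) ?_ hx0
    rw [formE10_eq_sum]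
    refine Finset.sum_eq_zero fun i _ => ?_
    by_cases hi : formE10 (g h) (simpleRoot i) = 0
    · rw [hi, mul_zero]
    · rw [hx i (by simp [hi]), zero_mul]
  · refine mem_coordSub_filter (fun j _ => hd j) (fun i hi => absurd (Finset.mem_univ i) hi)
      (by rw [hg, ha.root]) ?_
    rw [hg]
    exact hort _ (Submodule.subset_span (Set.mem_range_self i))

theorem IsRootBasis.exists_isometry_span_eq_coordSub [Fintype κ] {a : κ → Fin 10 → ℤ}
    (ha : IsRootBasis formE10 a) {J : Finset (Fin 10)} (hJ : NegDefOn J)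
    (haJ : ∀ i, a i ∈ coordSub J) :
    ∃ g : (Fin 10 → ℤ) ≃ₗ[ℤ] (Fin 10 → ℤ), (∀ x y, formE10 (g x) (g y) = formE10 x y) ∧
      ∃ J', NegDefOn J' ∧ Submodule.span ℤ (Set.range (g ∘ a)) = coordSub J' := by
  induction J using Finset.strongInduction generalizing a with
  | _ J ih =>
    have hspan : Submodule.span ℤ (Set.range a) ≤ coordSub J := by
      rw [Submodule.span_le]
      rintro _ ⟨i, rfl⟩
      exact haJ i
    by_cases hall : ∀ j ∈ J, simpleRoot j ∈ Submodule.span ℤ (Set.range a)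
    · exact ⟨LinearEquiv.refl ℤ _, fun _ _ => rfl, J, hJ, le_antisymm hspan (coordSub_le hall)⟩
    push Not at hall
    obtain ⟨j, hj, hja⟩ := hall
    obtain ⟨D, hD, s, hs, hort⟩ :=
      exists_orthogonal_projection formE10 ha.linearIndependent ha.neg (simpleRoot j)
    have hhJ := (coordSub J).sub_mem ((coordSub J).smul_mem D (simpleRoot_mem_coordSub hj))
      (hspan hs)
    have hh0 : D • simpleRoot j - s ≠ 0 := fun h0 =>
      hja (ha.primitive D _ hD.ne' (by rwa [sub_eq_zero.mp h0]))
    set h := D • simpleRoot j - s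
    obtain ⟨g, hg, hgJ, hd⟩ := hJ.exists_isometry_dominant hhJ
    have hgmem : ∀ x ∈ coordSub J, g x ∈ coordSub J := fun x hx => by
      have := (coordSub J).add_mem (hgJ x) hx
      rwa [sub_add_cancel] at this
    have hlt : (J.filter fun j => formE10 (g h) (simpleRoot j) = 0) ⊂ J := by
      refine (Finset.filter_subset _ _).ssubset_of_ne fun heq => ?_
      refine (hJ _ (hgmem h hhJ) (by simpa using hh0)).ne ?_
      rw [formE10_eq_sum]
      refine Finset.sum_eq_zero fun i _ => ?_
      by_cases hi : i ∈ J
      · rw [← heq] at hi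
        rw [(Finset.mem_filter.mp hi).2, mul_zero]
      · rw [hgmem h hhJ i hi, zero_mul]
    obtain ⟨g', hg', J', hJ', hs'⟩ := ih _ hlt (ha.comp g hg)
      (fun x hx => hJ x fun i hi => hx i fun hi' => hi (Finset.filter_subset _ _ hi'))
      fun i => mem_coordSub_filter hd (hgmem _ (haJ i)) (by simp [hg, ha.root]) (by
        rw [Function.comp_apply, hg]
        exact hort _ (Submodule.subset_span (Set.mem_range_self i)))
    exact ⟨g.trans g', fun x y => by simp [hg, hg'], J', hJ', hs'⟩

theorem IsRootBasis.exists_isometry_eq_simpleRoot_of_span_eq [Fintype κ] {a : κ → Fin 10 → ℤ}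
    (ha : IsRootBasis formE10 a) {J : Finset (Fin 10)} (hJ : NegDefOn J)
    (hspan : Submodule.span ℤ (Set.range a) = coordSub J) :
    ∃ g : (Fin 10 → ℤ) ≃ₗ[ℤ] (Fin 10 → ℤ), (∀ x y, formE10 (g x) (g y) = formE10 x y) ∧
      ∀ i, ∃ j, g (a i) = simpleRoot j := by
  obtain ⟨D, hD, s, hs, hsa⟩ :=
    exists_mem_span_forall_apply_eq formE10 ha.linearIndependent ha.neg fun _ => 1
  obtain ⟨g, hg, hgJ, hd⟩ := hJ.exists_isometry_dominant (hspan ▸ hs)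
  refine ⟨g, hg, ?_⟩
  have hb := ha.comp g hg
  have hsb : ∀ i, formE10 (g s) ((g ∘ a) i) = D := fun i => by
    rw [Function.comp_apply, hg, hsa, mul_one]
  have hbJ : ∀ i, (g ∘ a) i ∈ coordSub J := fun i => by
    have := (coordSub J).add_mem (hgJ (a i))
      (hspan ▸ Submodule.subset_span (Set.mem_range_self i))
    rwa [sub_add_cancel] at this
  have heb : ∀ j ∈ J, simpleRoot j ∈ Submodule.span ℤ (Set.range (g ∘ a)) := fun j hj => by
    obtain ⟨y, hy⟩ := g.surjective (simpleRoot j)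
    rw [← hy, span_range_comp_linearEquiv, hspan]
    have := (coordSub J).sub_mem (simpleRoot_mem_coordSub hj) (hgJ y)
    rwa [hy, sub_sub_cancel] at this
  set b := g ∘ a
  have hb0 : ∀ i k, 0 ≤ b i k := fun i => by
    rcases formE10_nonneg_or_nonpos (hb.root i) with h | h
    · exact h
    · exfalso
      refine absurd (hsb i) (ne_of_lt (lt_of_le_of_lt ?_ hD))
      rw [formE10_eq_sum]
      refine Finset.sum_nonpos fun k _ => ?_
      by_cases hk : k ∈ J
      · exact mul_nonpos_of_nonpos_of_nonneg (h k) (hd k hk)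
      · rw [hbJ i k hk, zero_mul]
  have hex : ∀ j ∈ J, ∃ l, b l = simpleRoot j := by
    intro j hj
    obtain ⟨c, hc⟩ := (Submodule.mem_span_range_iff_exists_fun ℤ).mp (heb j hj)
    have hsum : 0 ≤ ∑ l, c l := by
      have h1 := hd j hj
      rw [← hc, map_sum] at h1
      simp only [map_smul, hsb, smul_eq_mul] at h1
      rw [← Finset.sum_mul] at h1
      exact nonneg_of_mul_nonneg_left h1 hD
    have hc0 : ∀ l, 0 ≤ c l := by
      rcases hb.nonneg_or_nonpos formE10_comm formE10_even c
        (by rw [hc, formE10_simpleRoot_self]) with h | h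
      · exact h
      · intro l
        exact ((Finset.sum_eq_zero_iff_of_nonpos fun l _ => h l).mp
          (le_antisymm (Finset.sum_nonpos fun l _ => h l) hsum) l (Finset.mem_univ l)).ge
    obtain ⟨l, hl⟩ : ∃ l, 0 < c l := by
      by_contra! h
      have : simpleRoot j = 0 := by
        rw [← hc]
        exact Finset.sum_eq_zero fun l _ => by rw [le_antisymm (h l) (hc0 l), zero_smul]
      simpa using congrFun this j
    have hbl : b l = b l j • simpleRoot j := by
      funext k
      by_cases hk : k = j
      · subst hk
        simp
      · have h1 := congrFun hc k
        rw [simpleRoot, Pi.single_eq_of_ne hk, Finset.sum_apply] at h1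
        have h2 := (Finset.sum_eq_zero_iff_of_nonneg fun l _ =>
          mul_nonneg (hc0 l) (hb0 l k)).mp h1 l (Finset.mem_univ l)
        simpa [hk] using (mul_eq_zero.mp h2).resolve_left hl.ne'
    have hr := hb.root l
    rw [hbl] at hr
    simp only [map_smul, LinearMap.smul_apply, smul_eq_mul, formE10_simpleRoot_self] at hr
    refine ⟨l, ?_⟩
    have h1 : b l j = 1 := by
      have := hb0 l j
      nlinarith
    rw [hbl, h1, one_smul]
  intro i
  by_contra! hi
  refine hb.linearIndependent.notMem_span_image (s := {l | ∃ j, b l = simpleRoot j})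
    (x := i) (fun ⟨j, hj⟩ => hi j hj) (coordSub_le (fun j hj => ?_) (hbJ i))
  obtain ⟨l, hl⟩ := hex j hj
  exact Submodule.subset_span ⟨l, ⟨j, hl⟩, hl⟩

/-- Every basis of simple roots of a primitive negative definite root sublattice of `E₁₀` can be
moved to a set of simple roots of `E₁₀`. -/
theorem IsRootBasis.exists_isometry_eq_simpleRoot [Fintype κ] {a : κ → Fin 10 → ℤ}
    (ha : IsRootBasis formE10 a) :
    ∃ g : (Fin 10 → ℤ) ≃ₗ[ℤ] (Fin 10 → ℤ), (∀ x y, formE10 (g x) (g y) = formE10 x y) ∧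
      ∃ f : κ → Fin 10, ∀ i, g (a i) = simpleRoot (f i) := by
  obtain ⟨g₁, hg₁, J, hJ, haJ⟩ := ha.exists_isometry_mem_coordSub
  obtain ⟨g₂, hg₂, J', hJ', hs⟩ := (ha.comp g₁ hg₁).exists_isometry_span_eq_coordSub hJ haJ
  obtain ⟨g₃, hg₃, h⟩ :=
    ((ha.comp g₁ hg₁).comp g₂ hg₂).exists_isometry_eq_simpleRoot_of_span_eq hJ' hs
  choose f hf using h
  exact ⟨(g₁.trans g₂).trans g₃, fun x y => by simp [hg₁, hg₂, hg₃], f, hf⟩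

end RootSublattices

instance (n : ℕ) (M : Matrix (Fin n) (Fin n) ℤ) (a b : Fin n) : Decidable (0 ≤ M a b) :=
  Int.decLe _ _

theorem nodes_D6 : ∀ a b : Fin 10, E10G a b = 1 → ∀ c, E10G a c = 0 → E10G b c = 1 →
    ∀ d, E10G a d = 0 → E10G b d = 0 → E10G c d = 1 →
    ∀ e, E10G a e = 0 → E10G b e = 0 → E10G c e = 0 → E10G d e = 1 →
    ∀ f, E10G a f = 0 → E10G b f = 0 → E10G c f = 0 → E10G d f = 1 → E10G e f = 0 →
    ∀ x, x ∈ [a, b, c, d, e, f] ↔ x ∈ [1, 2, 3, 4, 5, 7] := by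
  decide +kernel

theorem nodes_E7 : ∀ a b : Fin 10, E10G a b = 1 → ∀ c, E10G a c = 0 → E10G b c = 1 →
    ∀ d, E10G a d = 0 → E10G b d = 0 → E10G c d = 1 →
    ∀ e, E10G a e = 0 → E10G b e = 0 → E10G c e = 0 → E10G d e = 1 →
    ∀ f, E10G a f = 0 → E10G b f = 0 → E10G c f = 0 → E10G d f = 0 → E10G e f = 1 →
    ∀ g, E10G a g = 0 → E10G b g = 0 → E10G c g = 0 → E10G d g = 1 → E10G e g = 0 →
      E10G f g = 0 →
    ∀ x, x ∈ [a, b, c, d, e, f, g] ↔ x ∈ [1, 2, 3, 4, 5, 6, 7] := by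
  decide +kernel

set_option synthInstance.maxHeartbeats 200000 in
set_option synthInstance.maxSize 1000 in
theorem nodes_E8 : ∀ a b : Fin 10, E10G a b = 1 → ∀ c, E10G a c = 0 → E10G b c = 1 →
    ∀ d, E10G a d = 0 → E10G b d = 0 → E10G c d = 1 →
    ∀ e, E10G a e = 0 → E10G b e = 0 → E10G c e = 0 → E10G d e = 1 →
    ∀ f, E10G a f = 0 → E10G b f = 0 → E10G c f = 0 → E10G d f = 0 → E10G e f = 1 →
    ∀ g, E10G a g = 0 → E10G b g = 0 → E10G c g = 0 → E10G d g = 0 → E10G e g = 0 →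
      E10G f g = 1 →
    ∀ h, E10G a h = 0 → E10G b h = 0 → E10G c h = 0 → E10G d h = 0 → E10G e h = 1 →
      E10G f h = 0 → E10G g h = 0 →
    ∀ x, x ∈ [a, b, c, d, e, f, g, h] ↔ x ∈ [0, 1, 2, 3, 4, 5, 6, 7] := by
  decide +kernel

/-- The sublattice spanned by the simple roots in `s`. -/
def nodeSpan (s : Set (Fin 10)) : Submodule ℤ (Fin 10 → ℤ) :=
  Submodule.span ℤ (simpleRoot '' s)

theorem exists_reflection (j : Fin 10) : ∃ r : (Fin 10 → ℤ) ≃ₗ[ℤ] (Fin 10 → ℤ),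
    (∀ x y, formE10 (r x) (r y) = formE10 x y) ∧
    ∀ x, r x = x + formE10 x (simpleRoot j) • simpleRoot j := by
  have hf : (-(formE10 (simpleRoot j))) (simpleRoot j) = 2 := by
    rw [LinearMap.neg_apply, formE10_simpleRoot_self, neg_neg]
  have hr : ∀ x, Module.reflection hf x = x + formE10 x (simpleRoot j) • simpleRoot j := by
    intro x
    rw [Module.reflection_apply, LinearMap.neg_apply, formE10_comm (simpleRoot j) x, neg_smul,
      sub_neg_eq_add]
  refine ⟨Module.reflection hf, fun x y => ?_, hr⟩
  rw [hr, hr]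
  simp only [map_add, map_smul, LinearMap.add_apply, LinearMap.smul_apply, smul_eq_mul,
    formE10_simpleRoot_self, formE10_comm (simpleRoot j) y]
  ring

theorem exists_isometry_map_slide (l : List (Fin 10)) {p : Fin 10 × Fin 10}
    (hp : E10G p.1 p.2 = 1) :
    ∃ g : (Fin 10 → ℤ) ≃ₗ[ℤ] (Fin 10 → ℤ), (∀ x y, formE10 (g x) (g y) = formE10 x y) ∧
      (nodeSpan {c | c ∈ l}).map (g : (Fin 10 → ℤ) →ₗ[ℤ] (Fin 10 → ℤ)) =
        nodeSpan {c | c ∈ slide l p} := by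
  by_cases h : ∀ c ∈ l, c ≠ p.1 → E10G c p.1 = 0 ∧ E10G c p.2 = 0
  · obtain ⟨r, hr, hr'⟩ := exists_reflection p.2
    obtain ⟨t, ht, ht'⟩ := exists_reflection p.1
    have hp' : E10G p.2 p.1 = 1 := by
      rw [← formE10_simpleRoot, formE10_comm, formE10_simpleRoot, hp]
    refine ⟨r.trans t, fun x y => by simp [hr, ht], ?_⟩
    have himg : ∀ c ∈ l, t (r (simpleRoot c)) = simpleRoot (if c = p.1 then p.2 else c) := by
      intro c hc
      split_ifs with hcp
      · rw [hr', ht', hcp, formE10_simpleRoot, hp, one_smul, map_add, LinearMap.add_apply,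
          formE10_simpleRoot_self, formE10_simpleRoot, hp']
        norm_num
      · obtain ⟨h1, h2⟩ := h c hc hcp
        rw [hr', ht', formE10_simpleRoot, h2, zero_smul, add_zero, formE10_simpleRoot, h1,
          zero_smul, add_zero]
    rw [nodeSpan, nodeSpan, Submodule.map_span, slide, if_pos h, Set.image_image]
    congr 1
    ext x
    simp only [Set.mem_image, Set.mem_ofPred_eq, List.mem_map]
    constructor
    · rintro ⟨c, hc, rfl⟩
      exact ⟨_, ⟨c, hc, rfl⟩, (himg c hc).symm⟩
    · rintro ⟨_, ⟨c, hc, rfl⟩, rfl⟩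
      exact ⟨c, hc, himg c hc⟩
  · exact ⟨LinearEquiv.refl ℤ _, fun _ _ => rfl, by rw [slide, if_neg h]; exact Submodule.map_id _⟩

theorem exists_isometry_map_foldl_slide (w : List (Fin 10 × Fin 10))
    (hw : ∀ p ∈ w, E10G p.1 p.2 = 1) (l : List (Fin 10)) :
    ∃ g : (Fin 10 → ℤ) ≃ₗ[ℤ] (Fin 10 → ℤ), (∀ x y, formE10 (g x) (g y) = formE10 x y) ∧
      (nodeSpan {c | c ∈ l}).map (g : (Fin 10 → ℤ) →ₗ[ℤ] (Fin 10 → ℤ)) =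
        nodeSpan {c | c ∈ w.foldl slide l} := by
  induction w generalizing l with
  | nil => exact ⟨LinearEquiv.refl ℤ _, fun _ _ => rfl, Submodule.map_id _⟩
  | cons p w ih =>
    obtain ⟨g, hg, hgl⟩ := exists_isometry_map_slide l (hw p List.mem_cons_self)
    obtain ⟨g', hg', hgl'⟩ := ih (fun q hq => hw q (List.mem_cons_of_mem _ hq)) (slide l p)
    refine ⟨g.trans g', fun x y => by simp [hg, hg'], ?_⟩
    rw [List.foldl_cons, ← hgl', ← hgl, ← Submodule.map_comp]
    rfl

/-- `G` is the Gram matrix of a basis of simple roots, and all the ways to realize it by nodes of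
the `E₁₀` diagram are equivalent under isometries. -/
structure IsRigidGram {n : ℕ} (G : Matrix (Fin n) (Fin n) ℤ) : Prop where
  diag : ∀ i, G i i = -2
  off : ∀ i j, i ≠ j → 0 ≤ G i j
  rigid : ∃ N, ∀ f : Fin n → Fin 10, (∀ i j, E10G (f i) (f j) = G i j) →
    ∃ g : (Fin 10 → ℤ) ≃ₗ[ℤ] (Fin 10 → ℤ), (∀ x y, formE10 (g x) (g y) = formE10 x y) ∧
      (nodeSpan (Set.range f)).map (g : (Fin 10 → ℤ) →ₗ[ℤ] (Fin 10 → ℤ)) = N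

theorem IsRigidGram.of_slides {n : ℕ} {G : Matrix (Fin n) (Fin n) ℤ} (hdiag : ∀ i, G i i = -2)
    (hoff : ∀ i j, i ≠ j → 0 ≤ G i j) (w : List (Fin 10 × Fin 10))
    (hw : ∀ p ∈ w, E10G p.1 p.2 = 1) (l : List (Fin 10))
    (h : ∀ f : Fin n → Fin 10, (∀ i j, E10G (f i) (f j) = G i j) →
      ∃ l', (∀ x, x ∈ l' ↔ x ∈ Set.range f) ∧ ∀ x, x ∈ w.foldl slide l' ↔ x ∈ l) :
    IsRigidGram G where
  diag := hdiag
  off := hoff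
  rigid := by
    refine ⟨nodeSpan {c | c ∈ l}, fun f hf => ?_⟩
    obtain ⟨l', hl', hl⟩ := h f hf
    obtain ⟨g, hg, hgl⟩ := exists_isometry_map_foldl_slide w hw l'
    refine ⟨g, hg, ?_⟩
    have h1 : {c | c ∈ w.foldl slide l'} = {c | c ∈ l} := Set.ext hl
    have h2 : {c | c ∈ l'} = Set.range f := Set.ext hl'
    rw [← h1, ← h2, hgl]

theorem isRigidGram_A1pow {k : ℕ} (l : List (Fin 10))
    (h : ∀ f : Fin k → Fin 10, StrictMono f → (∀ i j, i ≠ j → E10G (f i) (f j) = 0) →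
      ∀ x, x ∈ slidesA1.foldl slide (List.ofFn f) ↔ x ∈ l) : IsRigidGram (A1pow k) := by
  refine IsRigidGram.of_slides (fun i => Matrix.diagonal_apply_eq _ _)
    (fun i j hij => (Matrix.diagonal_apply_ne _ hij).ge) slidesA1 (by decide +kernel) l
    fun f hf => ⟨List.ofFn (f ∘ Tuple.sort f), fun x => ?_, h _ ?_ ?_⟩
  · rw [List.mem_ofFn', (Tuple.sort f).surjective.range_comp]
  · refine (Tuple.monotone_sort f).strictMono_of_injective
      (Function.Injective.comp (fun i j hij => ?_) (Tuple.sort f).injective)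
    by_contra hne
    have h1 := hf i j
    rw [hij, E10G_diag, A1pow, Matrix.diagonal_apply_ne _ hne] at h1
    omega
  · intro i j hij
    rw [Function.comp_apply, Function.comp_apply, hf]
    exact Matrix.diagonal_apply_ne _ fun h => hij ((Tuple.sort f).injective h)

theorem isRigidGram_A1_zero : IsRigidGram (A1pow 0) :=
  isRigidGram_A1pow [] fun f _ _ x => by
    rw [List.ofFn_zero]
    revert x
    decide +kernel

theorem isRigidGram_A1_one : IsRigidGram (A1pow 1) :=
  isRigidGram_A1pow [5] fun f _ _ => by simpa [List.ofFn_succ] using slides_A1_one (f 0)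

theorem isRigidGram_A1_two : IsRigidGram (A1pow 2) :=
  isRigidGram_A1pow [3, 5] fun f hm h => slides_A1_two (f 0) (f 1) (hm (by decide))
    (h _ _ (by decide))

theorem isRigidGram_A1_three : IsRigidGram (A1pow 3) :=
  isRigidGram_A1pow [2, 4, 6] fun f hm h => slides_A1_three (f 0) (f 1) (hm (by decide))
    (h _ _ (by decide)) (f 2) (hm (by decide)) (h _ _ (by decide)) (h _ _ (by decide))

theorem isRigidGram_A1_four : IsRigidGram (A1pow 4) :=
  isRigidGram_A1pow [0, 2, 4, 6] fun f hm h => slides_A1_four (f 0) (f 1) (hm (by decide))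
    (h _ _ (by decide)) (f 2) (hm (by decide)) (h _ _ (by decide)) (h _ _ (by decide))
    (f 3) (hm (by decide)) (h _ _ (by decide)) (h _ _ (by decide)) (h _ _ (by decide))

theorem isRigidGram_D4 : IsRigidGram D4G :=
  IsRigidGram.of_slides (by decide +kernel) (by decide +kernel) [] (by simp) [3, 4, 5, 7]
    fun f h => ⟨List.ofFn f, fun x => List.mem_ofFn' f x, nodes_D4 _ _ (h 0 1) _ (h 0 2) (h 1 2) _
      (h 0 3) (h 1 3) (h 2 3)⟩

theorem isRigidGram_D4A1 : IsRigidGram D4A1G :=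
  IsRigidGram.of_slides (by decide +kernel) (by decide +kernel) slidesD4A1 (by decide +kernel)
    [3, 4, 5, 7, 9] fun f h => ⟨List.ofFn f, fun x => List.mem_ofFn' f x,
      slides_D4A1 _ _ (h 0 1) _ (h 0 2) (h 1 2) _ (h 0 3) (h 1 3) (h 2 3) _ (h 0 4) (h 1 4)
      (h 2 4) (h 3 4)⟩

theorem isRigidGram_D6 : IsRigidGram D6G :=
  IsRigidGram.of_slides (by decide +kernel) (by decide +kernel) [] (by simp) [1, 2, 3, 4, 5, 7]
    fun f h => ⟨List.ofFn f, fun x => List.mem_ofFn' f x, nodes_D6 _ _ (h 0 1) _ (h 0 2) (h 1 2) _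
      (h 0 3) (h 1 3) (h 2 3) _ (h 0 4) (h 1 4) (h 2 4) (h 3 4) _ (h 0 5) (h 1 5) (h 2 5) (h 3 5)
      (h 4 5)⟩

theorem isRigidGram_E7 : IsRigidGram E7G :=
  IsRigidGram.of_slides (by decide +kernel) (by decide +kernel) [] (by simp)
    [1, 2, 3, 4, 5, 6, 7]
    fun f h => ⟨List.ofFn f, fun x => List.mem_ofFn' f x, nodes_E7 _ _ (h 0 1) _ (h 0 2) (h 1 2) _
      (h 0 3) (h 1 3) (h 2 3) _ (h 0 4) (h 1 4) (h 2 4) (h 3 4) _ (h 0 5) (h 1 5) (h 2 5) (h 3 5)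
      (h 4 5) _ (h 0 6) (h 1 6) (h 2 6) (h 3 6) (h 4 6) (h 5 6)⟩

theorem isRigidGram_E8 : IsRigidGram E8G :=
  IsRigidGram.of_slides (by decide +kernel) (by decide +kernel) [] (by simp)
    [0, 1, 2, 3, 4, 5, 6, 7]
    fun f h => ⟨List.ofFn f, fun x => List.mem_ofFn' f x, nodes_E8 _ _ (h 0 1) _ (h 0 2) (h 1 2) _
      (h 0 3) (h 1 3) (h 2 3) _ (h 0 4) (h 1 4) (h 2 4) (h 3 4) _ (h 0 5) (h 1 5) (h 2 5) (h 3 5)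
      (h 4 5) _ (h 0 6) (h 1 6) (h 2 6) (h 3 6) (h 4 6) (h 5 6) _ (h 0 7) (h 1 7) (h 2 7) (h 3 7)
      (h 4 7) (h 5 7) (h 6 7)⟩

/-- Any two primitive embeddings of a negative definite lattice with rigid Gram matrix
into `E₁₀` differ by an isometry, up to automorphisms of the source. -/
theorem IsRigidGram.exists_isometry_map_range {n : ℕ} {G : Matrix (Fin n) (Fin n) ℤ}
    (hG : IsRigidGram G) (hneg : ∀ x : Fin n → ℤ, x ≠ 0 → x ⬝ᵥ G *ᵥ x < 0)
    (A A' : (Fin n → ℤ) →ₗ[ℤ] (Fin 10 → ℤ))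
    (hA : ∀ x y, formE10 (A x) (A y) = x ⬝ᵥ G *ᵥ y)
    (hA' : ∀ x y, formE10 (A' x) (A' y) = x ⬝ᵥ G *ᵥ y)
    (hprim : ∀ (c : ℤ) x, c ≠ 0 → c • x ∈ LinearMap.range A → x ∈ LinearMap.range A)
    (hprim' : ∀ (c : ℤ) x, c ≠ 0 → c • x ∈ LinearMap.range A' → x ∈ LinearMap.range A') :
    ∃ g : (Fin 10 → ℤ) ≃ₗ[ℤ] (Fin 10 → ℤ), (∀ x y, formE10 (g x) (g y) = formE10 x y) ∧
      (LinearMap.range A).map (g : (Fin 10 → ℤ) →ₗ[ℤ] (Fin 10 → ℤ)) = LinearMap.range A' := by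
  obtain ⟨N, hN⟩ := hG.rigid
  have key : ∀ A : (Fin n → ℤ) →ₗ[ℤ] (Fin 10 → ℤ),
      (∀ x y, formE10 (A x) (A y) = x ⬝ᵥ G *ᵥ y) →
      (∀ (c : ℤ) x, c ≠ 0 → c • x ∈ LinearMap.range A → x ∈ LinearMap.range A) →
      ∃ g : (Fin 10 → ℤ) ≃ₗ[ℤ] (Fin 10 → ℤ), (∀ x y, formE10 (g x) (g y) = formE10 x y) ∧
        (LinearMap.range A).map (g : (Fin 10 → ℤ) →ₗ[ℤ] (Fin 10 → ℤ)) = N := by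
    intro A hA hprim
    have hspan : Submodule.span ℤ (Set.range fun k => A (Pi.single k 1)) = LinearMap.range A := by
      have h : (fun k => A (Pi.single k 1)) = A ∘ Pi.basisFun ℤ (Fin n) := by
        funext k
        simp
      rw [h, Set.range_comp, ← Submodule.map_span, Module.Basis.span_eq, LinearMap.range_eq_map]
    have hgram : ∀ i k, formE10 (A (Pi.single i 1)) (A (Pi.single k 1)) = G i k := fun i k => by
      rw [hA]
      simp
    have ha : IsRootBasis formE10 fun k => A (Pi.single k 1) := by
      refine ⟨?_, ?_, ?_, fun i => by rw [hgram, hG.diag], fun i k hik => by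
        rw [hgram]; exact hG.off i k hik⟩
      · rw [Fintype.linearIndependent_iff]
        intro c hc
        have h0 : A c = 0 := by
          rw [← hc]
          conv_lhs => rw [pi_eq_sum_univ' c, map_sum]
          simp only [map_smul]
        by_contra! hne
        have hc0 : c ≠ 0 := by
          rintro rfl
          simp at hne
        have := hneg c hc0
        rw [← hA, h0] at this
        simp at this
      · rw [hspan]
        rintro _ ⟨y, rfl⟩ hy
        rw [hA]
        exact hneg y fun h => hy (by rw [h, map_zero])
      · rw [hspan]
        exact hprim
    obtain ⟨g, hg, f, hf⟩ := ha.exists_isometry_eq_simpleRoot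
    obtain ⟨g', hg', h⟩ := hN f fun i k => by
      rw [← formE10_simpleRoot, ← hf, ← hf, hg, hgram]
    refine ⟨g.trans g', fun x y => by simp [hg, hg'], ?_⟩
    rw [← h, ← hspan, LinearEquiv.coe_trans, Submodule.map_comp, Submodule.map_span,
      ← Set.range_comp, nodeSpan, ← Set.range_comp]
    congr 3
    funext i
    exact hf i
  obtain ⟨g, hg, h⟩ := key A hA hprim
  obtain ⟨g', hg', h'⟩ := key A' hA' hprim'
  refine ⟨g.trans g'.symm, fun x y => ?_, ?_⟩
  · rw [← hg', LinearEquiv.trans_apply, LinearEquiv.trans_apply, LinearEquiv.apply_symm_apply,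
      LinearEquiv.apply_symm_apply, hg]
  · rw [LinearEquiv.coe_trans, Submodule.map_comp, h, ← h', ← Submodule.map_comp,
      LinearEquiv.comp_coe, LinearEquiv.self_trans_symm]
    exact Submodule.map_id _

theorem mem_range_of_smul_mem {E M : Type*} [AddCommGroup E] [AddCommGroup M] {A : E →ₗ[ℤ] M}
    (h : ∀ (n : ℤ) (y : M ⧸ LinearMap.range A), n ≠ 0 → n • y = 0 → y = 0) {c : ℤ} {x : M}
    (hc : c ≠ 0) (hx : c • x ∈ LinearMap.range A) : x ∈ LinearMap.range A := by
  rw [← Submodule.Quotient.mk_eq_zero]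
  refine h c _ hc ?_
  rw [← Submodule.Quotient.mk_smul]
  exact (Submodule.Quotient.mk_eq_zero _).mpr hx

theorem gram10_apply (x y : Fin 2 ⊕ Fin 8 → ℤ) : x ⬝ᵥ Gram10 *ᵥ y =
    (fun k => x (Sum.inl k)) ⬝ᵥ UG *ᵥ (fun k => y (Sum.inl k)) +
      (fun k => x (Sum.inr k)) ⬝ᵥ E8G *ᵥ fun k => y (Sum.inr k) := by
  simp [dotProduct, Matrix.mulVec, Gram10]

/-- An isometry of `U ⊕ E₈` carrying the image of `i` to that of `j` identifies
the orthogonal complements. -/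
theorem exists_equiv_orthogonal {E : Type*} [AddCommGroup E] (j : E →ₗ[ℤ] (Fin 8 → ℤ))
    (Sminus : Submodule ℤ (Fin 8 → ℤ))
    (hSm : ∀ x, x ∈ Sminus ↔ ∀ s, (j s) ⬝ᵥ E8G.mulVec x = 0)
    (i : E →ₗ[ℤ] (Fin 2 ⊕ Fin 8 → ℤ)) (Kplus : Submodule ℤ (Fin 2 ⊕ Fin 8 → ℤ))
    (hK : ∀ x, x ∈ Kplus ↔ ∀ s, B2 (i s) x = 0)
    (g : (Fin 2 ⊕ Fin 8 → ℤ) ≃ₗ[ℤ] (Fin 2 ⊕ Fin 8 → ℤ))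
    (hg : ∀ x y, g x ⬝ᵥ Gram10 *ᵥ g y = x ⬝ᵥ Gram10 *ᵥ y)
    (hij : ∀ s, ∃ t, g (i s) = Sum.elim (0 : Fin 2 → ℤ) (j t))
    (hji : ∀ t, ∃ s, g (i s) = Sum.elim (0 : Fin 2 → ℤ) (j t)) :
    ∃ e : ↥Kplus ≃ₗ[ℤ] ((Fin 2 → ℤ) × ↥Sminus), ∀ x y : ↥Kplus,
      B2 (x : (Fin 2 ⊕ Fin 8) → ℤ) (y : (Fin 2 ⊕ Fin 8) → ℤ) =
        2 * ((e x).1 ⬝ᵥ UG.mulVec ((e y).1)) +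
        2 * (((e x).2 : Fin 8 → ℤ) ⬝ᵥ E8G.mulVec ((e y).2 : Fin 8 → ℤ)) := by
  have hort : ∀ t z, Sum.elim (0 : Fin 2 → ℤ) (j t) ⬝ᵥ Gram10 *ᵥ z =
      j t ⬝ᵥ E8G *ᵥ fun k => z (Sum.inr k) := fun t z => by
    rw [gram10_apply]
    simp only [Sum.elim_inl, Sum.elim_inr, Pi.zero_apply]
    exact add_eq_right.mpr (zero_dotProduct _)
  have hmem : ∀ x, x ∈ Kplus ↔ (fun k => g x (Sum.inr k)) ∈ Sminus := by
    intro x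
    rw [hK, hSm]
    constructor
    · intro h t
      obtain ⟨s, hs⟩ := hji t
      have := h s
      rw [B2, ← hg, hs, hort] at this
      omega
    · intro h s
      obtain ⟨t, ht⟩ := hij s
      rw [B2, ← hg, ht, hort, h t, mul_zero]
  let e : ↥Kplus ≃ₗ[ℤ] ((Fin 2 → ℤ) × ↥Sminus) :=
    { toFun := fun x => (fun k => g x (Sum.inl k), ⟨fun k => g x (Sum.inr k), (hmem x).mp x.2⟩)
      map_add' := fun x y => by
        ext k
        · simp
        · simp
      map_smul' := fun c x => by
        ext k
        · simp [-zsmul_eq_mul]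
        · simp [-zsmul_eq_mul]
      invFun := fun z => ⟨g.symm (Sum.elim z.1 z.2), (hmem _).mpr (by simp)⟩
      left_inv := fun x => by
        ext1
        exact g.symm_apply_eq.mpr (Sum.elim_comp_inl_inr (g x))
      right_inv := fun z => by
        ext k
        · simp
        · simp }
  refine ⟨e, fun x y => ?_⟩
  rw [B2, ← hg, gram10_apply, mul_add]
  rfl

/-- Corollary 5.3: Let `S₊` (with halved Gram matrix `G` from the list
`A₁^k (0 ≤ k ≤ 4), D₄, D₄⊕A₁, D₆, E₇, E₈`, so `S₊ = G(2)`) be primitively embedded via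
`i` into `L₊ ≅ U(2) ⊕ E₈(2)`, and let `S₋` be the orthogonal complement of the
image of a primitive embedding `j` of `S₊(1/2)` into `E₈`.  Then the orthogonal
complement `K₊ = S₊^⊥` in `L₊` is isometric to `U(2) ⊕ S₋(2)`. -/
theorem stmt_13 (m : ℕ) (G : Matrix (Fin m) (Fin m) ℤ)
    (hlist : MatIso G (A1pow 0) ∨ MatIso G (A1pow 1) ∨ MatIso G (A1pow 2) ∨
      MatIso G (A1pow 3) ∨ MatIso G (A1pow 4) ∨ MatIso G D4G ∨
      MatIso G D4A1G ∨ MatIso G D6G ∨ MatIso G E7G ∨ MatIso G E8G)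
    -- `j` : primitive embedding of `S₊(1/2)` into `E₈`, with orthogonal complement `S₋`
    (j : (Fin m → ℤ) →ₗ[ℤ] (Fin 8 → ℤ))
    (hj : Function.Injective j)
    (hjform : ∀ x y, (j x) ⬝ᵥ E8G.mulVec (j y) = x ⬝ᵥ G.mulVec y)
    (hjprim : ∀ (n : ℤ) (y : (Fin 8 → ℤ) ⧸ LinearMap.range j),
      n ≠ 0 → n • y = 0 → y = 0)
    (Sminus : Submodule ℤ (Fin 8 → ℤ))
    (hSm : ∀ x, x ∈ Sminus ↔ ∀ s, (j s) ⬝ᵥ E8G.mulVec x = 0)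
    -- `i` : primitive embedding of `S₊ = G(2)` into `L₊`, with orthogonal complement `K₊`
    (i : (Fin m → ℤ) →ₗ[ℤ] ((Fin 2 ⊕ Fin 8) → ℤ))
    (hi : Function.Injective i)
    (hiform : ∀ x y, B2 (i x) (i y) = 2 * (x ⬝ᵥ G.mulVec y))
    (hiprim : ∀ (n : ℤ) (y : ((Fin 2 ⊕ Fin 8) → ℤ) ⧸ LinearMap.range i),
      n ≠ 0 → n • y = 0 → y = 0)
    (Kplus : Submodule ℤ ((Fin 2 ⊕ Fin 8) → ℤ))
    (hK : ∀ x, x ∈ Kplus ↔ ∀ s, B2 (i s) x = 0) :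
    ∃ e : ↥Kplus ≃ₗ[ℤ] ((Fin 2 → ℤ) × ↥Sminus),
      ∀ x y : ↥Kplus,
        B2 (x : (Fin 2 ⊕ Fin 8) → ℤ) (y : (Fin 2 ⊕ Fin 8) → ℤ) =
          2 * ((e x).1 ⬝ᵥ UG.mulVec ((e y).1)) +
          2 * (((e x).2 : Fin 8 → ℤ) ⬝ᵥ E8G.mulVec ((e y).2 : Fin 8 → ℤ)) := by
  obtain ⟨n, G₀, ⟨e₀, he₀⟩, hG₀⟩ : ∃ (n : ℕ) (G₀ : Matrix (Fin n) (Fin n) ℤ),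
      MatIso G G₀ ∧ IsRigidGram G₀ := by
    rcases hlist with h | h | h | h | h | h | h | h | h | h
    exacts [⟨_, _, h, isRigidGram_A1_zero⟩, ⟨_, _, h, isRigidGram_A1_one⟩,
      ⟨_, _, h, isRigidGram_A1_two⟩, ⟨_, _, h, isRigidGram_A1_three⟩,
      ⟨_, _, h, isRigidGram_A1_four⟩, ⟨_, _, h, isRigidGram_D4⟩, ⟨_, _, h, isRigidGram_D4A1⟩,
      ⟨_, _, h, isRigidGram_D6⟩, ⟨_, _, h, isRigidGram_E7⟩, ⟨_, _, h, isRigidGram_E8⟩]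
  have he₀' : ∀ x y, e₀.symm x ⬝ᵥ G *ᵥ e₀.symm y = x ⬝ᵥ G₀ *ᵥ y := fun x y => by
    rw [he₀, e₀.apply_symm_apply, e₀.apply_symm_apply]
  have hform' : ∀ x y, formE10 (toHyperbolic.symm x) (toHyperbolic.symm y) =
      x ⬝ᵥ Gram10 *ᵥ y := fun x y => by
    rw [← toHyperbolic_isometry, LinearEquiv.apply_symm_apply, LinearEquiv.apply_symm_apply]
  let ι : (Fin 8 → ℤ) →ₗ[ℤ] (Fin 2 ⊕ Fin 8 → ℤ) :=
    { toFun := fun x => Sum.elim 0 x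
      map_add' := fun x y => by
        ext (k | k) <;> simp
      map_smul' := fun c x => by
        ext (k | k) <;> simp }
  have hι : ∀ x y, ι x ⬝ᵥ Gram10 *ᵥ ι y = x ⬝ᵥ E8G *ᵥ y := fun x y => by
    rw [gram10_apply]
    exact add_eq_right.mpr (zero_dotProduct _)
  let A : (Fin n → ℤ) →ₗ[ℤ] (Fin 10 → ℤ) :=
    (toHyperbolic.symm : _ →ₗ[ℤ] _) ∘ₗ i ∘ₗ (e₀.symm : _ →ₗ[ℤ] _)
  let A' : (Fin n → ℤ) →ₗ[ℤ] (Fin 10 → ℤ) :=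
    (toHyperbolic.symm : _ →ₗ[ℤ] _) ∘ₗ ι ∘ₗ j ∘ₗ (e₀.symm : _ →ₗ[ℤ] _)
  have hneg : ∀ x : Fin n → ℤ, x ≠ 0 → x ⬝ᵥ G₀ *ᵥ x < 0 := by
    intro x hx
    rw [← he₀', ← hjform]
    by_contra! h
    exact hx (by simpa using hj ((E8_neg h).trans (map_zero j).symm))
  have hA : ∀ x y, formE10 (A x) (A y) = x ⬝ᵥ G₀ *ᵥ y := by
    intro x y
    have := hiform (e₀.symm x) (e₀.symm y)
    rw [B2, he₀'] at this
    rw [← mul_left_cancel₀ two_ne_zero this]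
    exact hform' _ _
  have hA' : ∀ x y, formE10 (A' x) (A' y) = x ⬝ᵥ G₀ *ᵥ y := by
    intro x y
    rw [← he₀', ← hjform, ← hι]
    exact hform' _ _
  have hprim : ∀ (c : ℤ) x, c ≠ 0 → c • x ∈ LinearMap.range A → x ∈ LinearMap.range A := by
    rintro c x hc ⟨s, hs⟩
    obtain ⟨t, ht⟩ := mem_range_of_smul_mem hiprim hc (x := toHyperbolic x) ⟨e₀.symm s, by
      rw [← map_smul, ← hs]
      simp [A]⟩
    exact ⟨e₀ t, by simp [A, ht]⟩
  have hprim' : ∀ (c : ℤ) x, c ≠ 0 → c • x ∈ LinearMap.range A' → x ∈ LinearMap.range A' := by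
    rintro c x hc ⟨s, hs⟩
    have hs' : ι (j (e₀.symm s)) = c • toHyperbolic x := by
      rw [← map_smul, ← hs]
      simp [A']
    obtain ⟨t, ht⟩ := mem_range_of_smul_mem hjprim hc (x := fun k => toHyperbolic x (Sum.inr k))
      ⟨e₀.symm s, funext fun k => congrFun hs' (Sum.inr k)⟩
    have h : ι (j t) = toHyperbolic x := by
      rw [ht]
      ext (k | k)
      · exact ((mul_eq_zero.mp (congrFun hs' (Sum.inl k)).symm).resolve_left hc).symm
      · rfl
    exact ⟨e₀ t, by simp [A', h]⟩
  obtain ⟨g, hg, hgA⟩ := hG₀.exists_isometry_map_range hneg A A' hA hA' hprim hprim'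
  refine exists_equiv_orthogonal j Sminus hSm i Kplus hK
    ((toHyperbolic.symm.trans g).trans toHyperbolic) (fun x y => ?_) (fun s => ?_) fun t => ?_
  · simp only [LinearEquiv.trans_apply]
    rw [toHyperbolic_isometry, hg, hform']
  · obtain ⟨t, ht⟩ : g (A (e₀ s)) ∈ LinearMap.range A' := by
      rw [← hgA]
      exact ⟨_, ⟨_, rfl⟩, rfl⟩
    refine ⟨e₀.symm t, ?_⟩
    have := congrArg toHyperbolic ht
    simpa [A, A', ι] using this.symm
  · have h : A' (e₀ t) ∈ LinearMap.range A' := ⟨_, rfl⟩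
    rw [← hgA] at h
    obtain ⟨_, ⟨s, rfl⟩, hs⟩ := h
    refine ⟨e₀.symm s, ?_⟩
    have := congrArg toHyperbolic hs
    simpa [A, A', ι] using this
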